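/- arXiv:2204.08752 — 3 statements merged into one kernel-verified Lean document; each statement's English description precedes it below -/
import Mathlib

section
/- Let m, d be integers with m ≥ d ≥ 2, N = m^d, and let θ ∈ [0, π/2]. Then 𝔼L₂²(P_{Ω*∼(θ)}) ≤ d/N^{1+1/d} + (1/N³)·(1/3^{d−2})·P(θ). -/
open MeasureTheory Real Set

noncomputable section

/-- The unit cube `[0,1]^d`. -/
def unitCube (d : ℕ) : Set (Fin d → ℝ) := Set.univ.pi fun _ => Set.Icc (0 : ℝ) 1

/-- The anchored half-open box `[0, z) = ∏ⱼ [0, zⱼ)`. -/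
def lowerBox {d : ℕ} (z : Fin d → ℝ) : Set (Fin d → ℝ) := {y | ∀ i, 0 ≤ y i ∧ y i < z i}

/-- The squared `L₂`-discrepancy of a point configuration `P` in `[0,1]^d`:
`∫_{[0,1]^d} (λ([0,z)) - (1/N) #{i : P i ∈ [0,z)})² dz`. -/
def L2sq {d : ℕ} {ι : Type} [Fintype ι] (P : ι → Fin d → ℝ) : ℝ :=
  ∫ z in unitCube d,
    ((volume (lowerBox z)).toReal
      - (Fintype.card ι : ℝ)⁻¹ * (Nat.card {i // P i ∈ lowerBox z} : ℝ)) ^ 2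

/-- The joint distribution of the stratified sample associated to a partition `Ω`:
independent points, the `i`-th uniformly distributed on `Ω i`. -/
def stratified {d : ℕ} {ι : Type} [Fintype ι] (Ω : ι → Set (Fin d → ℝ)) :
    Measure (ι → Fin d → ℝ) :=
  Measure.pi fun i => ProbabilityTheory.cond volume (Ω i)

/-- Expected squared `L₂`-discrepancy of the stratified sample from the partition `Ω`. -/
def expL2sq {d : ℕ} {ι : Type} [Fintype ι] (Ω : ι → Set (Fin d → ℝ)) : ℝ :=
  ∫ P, L2sq P ∂(stratified Ω)

/-- The rectangle `I = [0,2] × [0,1] ⊆ ℝ²`. -/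
def I2 : Set (ℝ × ℝ) := Set.Icc (0 : ℝ) 2 ×ˢ Set.Icc (0 : ℝ) 1

open scoped Classical in
/-- The cell `Ω₁(θ)` of the one-parameter family of partitions of `[0,2] × [0,1]`. -/
def Omega1 (θ : ℝ) : Set (ℝ × ℝ) :=
  if θ = π / 2 then Set.Icc (0 : ℝ) 1 ×ˢ Set.Icc (0 : ℝ) 1
  else if θ < arctan (1 / 2) then {p ∈ I2 | p.2 ≤ (1 - p.1) * tan θ + 1 / 2}
  else {p ∈ I2 | (p.1 - 1) * tan θ + p.2 ≤ 1 / 2}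

/-- The cell `Ω₂(θ)`: the closure of the complement of `Ω₁(θ)` in `[0,2] × [0,1]`. -/
def Omega2 (θ : ℝ) : Set (ℝ × ℝ) := closure (I2 \ Omega1 θ)

/-- The anchor point `a = ((m-2)/m, (m-1)/m, …, (m-1)/m)`. -/
def anchor (m d : ℕ) : Fin d → ℝ := fun j => if (j : ℕ) = 0 then ((m : ℝ) - 2) / m else ((m : ℝ) - 1) / m

/-- The two corner cells `a + (1/m)·(Ωᵢ(θ) × [0,1]^{d-2})`, `i = 1, 2`. -/
def cornerCell (m d : ℕ) (hd : 2 ≤ d) (θ : ℝ) (i : Fin 2) : Set (Fin d → ℝ) :=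
  (fun x : Fin d → ℝ => fun j => anchor m d j + x j / m) ''
    {x : Fin d → ℝ |
      (x ⟨0, by omega⟩, x ⟨1, by omega⟩) ∈ (if i = 0 then Omega1 θ else Omega2 θ) ∧
      ∀ j : Fin d, 2 ≤ (j : ℕ) → x j ∈ Set.Icc (0 : ℝ) 1}

/-- The axis-parallel grid cell of side `1/m` indexed by `k`. -/
def gridCell {d : ℕ} (m : ℕ) (k : Fin d → Fin m) : Set (Fin d → ℝ) :=
  Set.univ.pi fun j => Set.Ico ((k j : ℝ) / m) (((k j : ℝ) + 1) / m)

open scoped Classical in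
/-- The partition `Ω*∼(θ)` of `[0,1]^d`: all grid cells of side `1/m` except the two
top-corner ones, which are replaced by the two cells `a + (1/m)·(Ωᵢ(θ) × [0,1]^{d-2})`. -/
def OmegaStarSim (m d : ℕ) (hd : 2 ≤ d) (θ : ℝ) : (Fin d → Fin m) → Set (Fin d → ℝ) :=
  fun k =>
    if ∀ j : Fin d, (k j : ℕ) = (if (j : ℕ) = 0 then m - 2 else m - 1) then
      cornerCell m d hd θ 0
    else if ∀ j : Fin d, (k j : ℕ) = m - 1 then cornerCell m d hd θ 1
    else gridCell m k

end

open scoped Classical in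
/-- The piecewise function `P(θ)` appearing in the expected `L₂`-discrepancy bounds. -/
noncomputable def Pfun (θ : ℝ) : ℝ :=
  if θ < Real.arctan (1 / 2) then
    (2 / 45) * Real.tan θ ^ 3 + (2 / 15) * Real.tan θ ^ 2 - (1 / 6) * Real.tan θ
  else if θ = Real.arctan (1 / 2) then -(2 / 45)
  else
    -(1 / 24) * Real.cot θ + (1 / 120) * Real.cot θ ^ 2 + (1 / 1440) * Real.cot θ ^ 3


theorem card_mem_eq_sum_indicator {d : ℕ} {ι : Type} [Fintype ι] (P : ι → Fin d → ℝ)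
    (B : Set (Fin d → ℝ)) :
    (Nat.card {i // P i ∈ B} : ℝ) = ∑ i, B.indicator (fun _ => (1 : ℝ)) (P i) := by
  classical
  rw [Nat.card_eq_fintype_card, Fintype.card_subtype]
  simp [Set.indicator_apply]

theorem cond_eq_zero_or_isProbabilityMeasure {α : Type*} [MeasurableSpace α] (μ : Measure α)
    (s : Set α) :
    ProbabilityTheory.cond μ s = 0 ∨ IsProbabilityMeasure (ProbabilityTheory.cond μ s) := by
  by_cases h : μ s = 0 ∨ μ s = ⊤
  · left
    rcases h with h | h
    · exact ProbabilityTheory.cond_eq_zero_of_meas_eq_zero h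
    · simp [ProbabilityTheory.cond, h]
  · push Not at h
    exact Or.inr (ProbabilityTheory.cond_isProbabilityMeasure_of_finite h.1 h.2)

theorem integral_sq_sub_card_pi {d : ℕ} {ι : Type} [Fintype ι]
    (ν : ι → Measure (Fin d → ℝ)) [∀ i, IsProbabilityMeasure (ν i)]
    {B : Set (Fin d → ℝ)} (hB : MeasurableSet B) (c r : ℝ) :
    ∫ P, (c - r * (Nat.card {i // P i ∈ B} : ℝ)) ^ 2 ∂(Measure.pi ν)
      = (c - r * ∑ i, (ν i).real B) ^ 2
        + r ^ 2 * ∑ i, (ν i).real B * (1 - (ν i).real B) := by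
  set f : (Fin d → ℝ) → ℝ := B.indicator (fun _ => 1) with hf
  have hfm : Measurable f := measurable_const.indicator hB
  have hfL (i : ι) : MemLp f 2 (ν i) := memLp_indicator_const 2 hB 1 (Or.inr (measure_ne_top _ _))
  have hfint (i : ι) : ∫ x, f x ∂(ν i) = (ν i).real B := by
    simp [hf, integral_indicator hB]
  have hvar (i : ι) : ProbabilityTheory.variance f (ν i) = (ν i).real B * (1 - (ν i).real B) := by
    have hsq : f ^ 2 = f := by
      ext x
      by_cases hx : x ∈ B <;> simp [hf, hx]
    rw [ProbabilityTheory.variance_eq_sub (hfL i), hsq, hfint]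
    ring
  have hcomp (i : ι) : MemLp (fun P : ι → Fin d → ℝ => f (P i)) 2 (Measure.pi ν) :=
    (hfL i).comp_measurePreserving (measurePreserving_eval ν i)
  set S : (ι → Fin d → ℝ) → ℝ := ∑ i, fun P => f (P i) with hS
  have hSL : MemLp S 2 (Measure.pi ν) := memLp_finsetSum' _ fun i _ => hcomp i
  have hSvar : ProbabilityTheory.variance S (Measure.pi ν)
      = ∑ i, (ν i).real B * (1 - (ν i).real B) := by
    rw [hS, ProbabilityTheory.variance_sum_pi hfL]
    simp [hvar]
  have hSint : ∫ P, S P ∂(Measure.pi ν) = ∑ i, (ν i).real B := by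
    simp only [hS, Finset.sum_apply]
    rw [integral_finsetSum _ fun i _ => (hcomp i).integrable (by norm_num)]
    refine Finset.sum_congr rfl fun i _ => ?_
    rw [← hfint i, ← (measurePreserving_eval ν i).map_eq, integral_map]
    · exact (measurable_pi_apply i).aemeasurable
    · exact hfm.aestronglyMeasurable
  have hrS : MemLp (fun P => r * S P) 2 (Measure.pi ν) := hSL.const_mul r
  have hL : MemLp (fun P => c - r * S P) 2 (Measure.pi ν) := (memLp_const c).sub hrS
  have key := ProbabilityTheory.variance_eq_sub hL
  rw [ProbabilityTheory.variance_const_sub hrS.1, ProbabilityTheory.variance_const_mul,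
    hSvar, integral_sub (integrable_const _) (hrS.integrable (by norm_num)),
    integral_const_mul, hSint] at key
  simp only [integral_const, probReal_univ, one_smul, Pi.pow_apply] at key
  simp only [card_mem_eq_sum_indicator]
  have hS' (P : ι → Fin d → ℝ) : ∑ i, B.indicator (fun _ => (1 : ℝ)) (P i) = S P := by
    simp [hS, hf]
  simp only [hS']
  linarith

theorem lowerBox_eq_pi {d : ℕ} (z : Fin d → ℝ) :
    lowerBox z = Set.univ.pi fun i => Set.Ico 0 (z i) := by
  ext y
  simp [lowerBox, Set.mem_pi]

theorem measurableSet_lowerBox {d : ℕ} (z : Fin d → ℝ) : MeasurableSet (lowerBox z) := by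
  rw [lowerBox_eq_pi]
  exact MeasurableSet.univ_pi fun _ => measurableSet_Ico

theorem volume_lowerBox_toReal {d : ℕ} (z : Fin d → ℝ) :
    (volume (lowerBox z)).toReal = ∏ i, max (z i) 0 := by
  rw [lowerBox_eq_pi, volume_pi_pi, ENNReal.toReal_prod]
  simp [Real.volume_Ico, ENNReal.toReal_ofReal']

theorem measurableSet_unitCube (d : ℕ) : MeasurableSet (unitCube d) :=
  MeasurableSet.univ_pi fun _ => measurableSet_Icc

theorem volume_unitCube (d : ℕ) : volume (unitCube d) = 1 := by
  rw [unitCube, volume_pi_pi]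
  simp

theorem integral_L2sq_pi {d : ℕ} {ι : Type} [Fintype ι]
    (ν : ι → Measure (Fin d → ℝ)) [∀ i, IsProbabilityMeasure (ν i)] :
    ∫ P, L2sq P ∂(Measure.pi ν)
      = ∫ z in unitCube d, ∫ P, ((volume (lowerBox z)).toReal
          - (Fintype.card ι : ℝ)⁻¹ * (Nat.card {i // P i ∈ lowerBox z} : ℝ)) ^ 2
            ∂(Measure.pi ν) := by
  have : IsFiniteMeasure (volume.restrict (unitCube d)) :=
    ⟨by simp [volume_unitCube]⟩
  unfold L2sq
  refine integral_integral_swap ?_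
  have hmeas : Measurable (Function.uncurry fun (P : ι → Fin d → ℝ) (z : Fin d → ℝ) =>
      ((volume (lowerBox z)).toReal
        - (Fintype.card ι : ℝ)⁻¹ * (Nat.card {i // P i ∈ lowerBox z} : ℝ)) ^ 2) := by
    simp only [Function.uncurry_def, volume_lowerBox_toReal, card_mem_eq_sum_indicator]
    have hind (i : ι) : Measurable fun x : (ι → Fin d → ℝ) × (Fin d → ℝ) =>
        (lowerBox x.2).indicator (fun _ => (1 : ℝ)) (x.1 i) := by
      have hset : MeasurableSet {x : (ι → Fin d → ℝ) × (Fin d → ℝ) | x.1 i ∈ lowerBox x.2} := by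
        have heq : {x : (ι → Fin d → ℝ) × (Fin d → ℝ) | x.1 i ∈ lowerBox x.2}
            = ⋂ j, ({x | 0 ≤ x.1 i j} ∩ {x | x.1 i j < x.2 j}) := by
          ext x
          simp [lowerBox]
        rw [heq]
        refine MeasurableSet.iInter fun j => ?_
        exact (measurableSet_le (by fun_prop) (by fun_prop)).inter
          (measurableSet_lt (by fun_prop) (by fun_prop))
      exact measurable_const.indicator (f := fun _ => (1 : ℝ)) hset
    fun_prop
  refine Integrable.of_bound hmeas.aestronglyMeasurable 1 ?_
  have hz : ∀ᵐ x ∂((Measure.pi ν).prod (volume.restrict (unitCube d))), x.2 ∈ unitCube d :=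
    Measure.quasiMeasurePreserving_snd.ae (ae_restrict_mem (measurableSet_unitCube d))
  filter_upwards [hz] with x hx
  have hx' : ∀ i, 0 ≤ x.2 i ∧ x.2 i ≤ 1 := fun i => hx i (Set.mem_univ i)
  have hv0 : 0 ≤ ∏ i, max (x.2 i) 0 := Finset.prod_nonneg fun i _ => le_max_right _ _
  have hv1 : ∏ i, max (x.2 i) 0 ≤ 1 :=
    Finset.prod_le_one (fun i _ => le_max_right _ _) fun i _ => max_le (hx' i).2 zero_le_one
  have hc : (Nat.card {i // x.1 i ∈ lowerBox x.2} : ℝ) ≤ Fintype.card ι := by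
    rw [← Nat.card_eq_fintype_card]
    exact_mod_cast Finite.card_subtype_le _
  have hc0 : 0 ≤ (Fintype.card ι : ℝ)⁻¹ * (Nat.card {i // x.1 i ∈ lowerBox x.2} : ℝ) := by
    positivity
  have hc1 : (Fintype.card ι : ℝ)⁻¹ * (Nat.card {i // x.1 i ∈ lowerBox x.2} : ℝ) ≤ 1 :=
    (mul_le_mul_of_nonneg_left hc (by positivity)).trans inv_mul_le_one
  simp only [Function.uncurry_def, volume_lowerBox_toReal, norm_pow, Real.norm_eq_abs, sq_abs]
  rw [sq_le_one_iff_abs_le_one, abs_le]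
  constructor <;> linarith

theorem mem_gridCell_iff {d m : ℕ} (hm : 0 < m) {k : Fin d → Fin m} {x : Fin d → ℝ} :
    x ∈ gridCell m k ↔ ∀ j, (k j : ℝ) ≤ m * x j ∧ m * x j < (k j : ℝ) + 1 := by
  have hm' : (0 : ℝ) < m := by exact_mod_cast hm
  simp only [gridCell, Set.mem_univ_pi, Set.mem_Ico, div_le_iff₀' hm', lt_div_iff₀' hm']

theorem measurableSet_gridCell {d m : ℕ} (k : Fin d → Fin m) : MeasurableSet (gridCell m k) :=
  MeasurableSet.univ_pi fun _ => measurableSet_Ico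

theorem volume_gridCell {d m : ℕ} (k : Fin d → Fin m) :
    volume (gridCell m k) = ENNReal.ofReal ((m : ℝ)⁻¹ ^ d) := by
  rw [gridCell, volume_pi_pi]
  have h (j : Fin d) : ((k j : ℝ) + 1) / m - (k j : ℝ) / m = (m : ℝ)⁻¹ := by ring
  simp only [Real.volume_Ico, h]
  rw [Finset.prod_const, Finset.card_univ, Fintype.card_fin, ENNReal.ofReal_pow (by positivity)]

theorem cond_gridCell_real {d m : ℕ} (k : Fin d → Fin m) (B : Set (Fin d → ℝ)) :
    (ProbabilityTheory.cond volume (gridCell m k)).real B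
      = (m : ℝ) ^ d * volume.real (gridCell m k ∩ B) := by
  have h0 : (0 : ℝ) ≤ (m : ℝ)⁻¹ ^ d := by positivity
  rw [measureReal_def, ProbabilityTheory.cond_apply (measurableSet_gridCell k), volume_gridCell,
    ENNReal.toReal_mul, ENNReal.toReal_inv, ENNReal.toReal_ofReal h0, inv_pow, inv_inv,
    measureReal_def]

theorem sum_volume_gridCell_inter_lowerBox {d m : ℕ} (hm : 0 < m) {z : Fin d → ℝ}
    (hz : z ∈ unitCube d) :
    ∑ k : Fin d → Fin m, volume.real (gridCell m k ∩ lowerBox z) = volume.real (lowerBox z) := by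
  have hm' : (0 : ℝ) < m := by exact_mod_cast hm
  have hfin : volume (lowerBox z) ≠ ⊤ := by
    rw [lowerBox_eq_pi, volume_pi_pi]
    exact ENNReal.prod_ne_top fun i _ => by simp
  have hcover : lowerBox z = ⋃ k ∈ (Finset.univ : Finset (Fin d → Fin m)),
      (gridCell m k ∩ lowerBox z) := by
    ext x
    simp only [Finset.mem_univ, Set.iUnion_true, Set.mem_iUnion, Set.mem_inter_iff,
      exists_and_right, iff_and_self]
    intro hx
    have hx0 (j : Fin d) : 0 ≤ (m : ℝ) * x j := mul_nonneg hm'.le (hx j).1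
    have hx1 (j : Fin d) : (m : ℝ) * x j < m := by
      have := (hx j).2.trans_le (hz j (Set.mem_univ j)).2
      nlinarith
    refine ⟨fun j => ⟨⌊(m : ℝ) * x j⌋₊, (Nat.floor_lt (hx0 j)).2 (hx1 j)⟩, ?_⟩
    rw [mem_gridCell_iff hm]
    exact fun j => ⟨Nat.floor_le (hx0 j), Nat.lt_floor_add_one _⟩
  have hdisj : (↑(Finset.univ : Finset (Fin d → Fin m)) : Set (Fin d → Fin m)).PairwiseDisjoint
      fun k => gridCell m k ∩ lowerBox z := by
    intro k _ l _ hkl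
    refine Set.disjoint_left.2 fun x hxk hxl => hkl ?_
    have h1 := (mem_gridCell_iff hm).1 hxk.1
    have h2 := (mem_gridCell_iff hm).1 hxl.1
    funext j
    have a : (k j : ℝ) < (l j : ℝ) + 1 := (h1 j).1.trans_lt (h2 j).2
    have b : (l j : ℝ) < (k j : ℝ) + 1 := (h2 j).1.trans_lt (h1 j).2
    norm_cast at a b
    exact Fin.ext (by omega)
  conv_rhs => rw [hcover]
  exact (measureReal_biUnion_finset hdisj
    (fun k _ => (measurableSet_gridCell k).inter (measurableSet_lowerBox z))
    fun k _ => measure_ne_top_of_subset Set.inter_subset_right hfin).symm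

theorem card_filter_exists_coord_eq_le {d m : ℕ} (c : Fin d → ℕ) :
    (Finset.univ.filter fun k : Fin d → Fin m => ∃ j, (k j : ℕ) = c j).card
      ≤ d * m ^ (d - 1) := by
  classical
  have hsub : (Finset.univ.filter fun k : Fin d → Fin m => ∃ j, (k j : ℕ) = c j)
      ⊆ Finset.univ.biUnion fun j => Finset.univ.filter fun k : Fin d → Fin m =>
          (k j : ℕ) = c j := by
    intro k
    simp
  refine (Finset.card_le_card hsub).trans ((Finset.card_biUnion_le_card_mul _ _ (m ^ (d - 1))
    fun j _ => ?_).trans_eq (by simp))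
  by_cases hj : c j < m
  · have h := Fintype.card_filter_piFinset_const (Finset.univ : Finset (Fin m)) j ⟨c j, hj⟩
    simp only [Fintype.piFinset_univ, Finset.mem_univ, if_true, Finset.card_univ,
      Fintype.card_fin] at h
    rw [← h]
    refine Finset.card_le_card fun k => ?_
    simp [Fin.ext_iff]
  · rw [Finset.filter_false_of_mem fun k _ (h : (k j : ℕ) = c j) =>
      hj (h ▸ (k j).2)]
    simp

theorem cond_gridCell_lowerBox_eq_zero_or_one {d m : ℕ} (hm : 0 < m) {z : Fin d → ℝ}
    (hz : z ∈ unitCube d) {k : Fin d → Fin m}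
    (hk : ¬ ∃ j, (k j : ℕ) = ⌊(m : ℝ) * z j⌋₊) :
    (ProbabilityTheory.cond volume (gridCell m k)).real (lowerBox z) = 0
      ∨ (ProbabilityTheory.cond volume (gridCell m k)).real (lowerBox z) = 1 := by
  have hm' : (0 : ℝ) < m := by exact_mod_cast hm
  rw [cond_gridCell_real]
  push Not at hk
  by_cases h : ∃ j, (m : ℝ) * z j < k j
  · left
    obtain ⟨j, hj⟩ := h
    have hempty : gridCell m k ∩ lowerBox z = ∅ := by
      ext x
      simp only [Set.mem_inter_iff, Set.mem_empty_iff_false, iff_false, not_and]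
      intro hx hxz
      have h1 := ((mem_gridCell_iff hm).1 hx j).1
      have h2 := (hxz j).2
      nlinarith
    simp [hempty]
  · right
    push Not at h
    have hsub : gridCell m k ∩ lowerBox z = gridCell m k := by
      refine Set.inter_eq_left.2 fun x hx j => ?_
      have hx' := (mem_gridCell_iff hm).1 hx j
      have hfl : (k j : ℕ) < ⌊(m : ℝ) * z j⌋₊ :=
        lt_of_le_of_ne (Nat.le_floor (h j)) (hk j)
      have hle : (k j : ℝ) + 1 ≤ m * z j := by
        have := Nat.floor_le (mul_nonneg hm'.le (hz j (Set.mem_univ j)).1)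
        have h3 : ((k j : ℕ) : ℝ) + 1 ≤ (⌊(m : ℝ) * z j⌋₊ : ℝ) := by exact_mod_cast hfl
        exact h3.trans this
      constructor
      · have : (0 : ℝ) ≤ m * x j := (Nat.cast_nonneg _).trans hx'.1
        exact nonneg_of_mul_nonneg_right this hm'
      · exact lt_of_mul_lt_mul_left (hx'.2.trans_le hle) hm'.le
    rw [hsub, measureReal_def, volume_gridCell, ENNReal.toReal_ofReal (by positivity), inv_pow]
    exact mul_inv_cancel₀ (by positivity)

theorem mul_one_sub_le_quarter (q : ℝ) : q * (1 - q) ≤ 1 / 4 := by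
  nlinarith [sq_nonneg (q - 1 / 2)]

/-- The mean square error at `z` of a stratified sample which agrees with the jittered grid sample
outside a set `T` of at most two strata. -/
theorem mean_sq_error_le {d m : ℕ} (hm : 0 < m) {z : Fin d → ℝ} (hz : z ∈ unitCube d)
    (q : (Fin d → Fin m) → ℝ) (T : Finset (Fin d → Fin m)) (hT : T.card ≤ 2) {e : ℝ}
    (he0 : 0 ≤ e) (he1 : e ≤ 1)
    (hq : ∀ k ∉ T, q k = (ProbabilityTheory.cond volume (gridCell m k)).real (lowerBox z))
    (hbias : ∀ k ∈ T,
      |(ProbabilityTheory.cond volume (gridCell m k)).real (lowerBox z) - q k| ≤ e)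
    (hvar : ∀ k ∈ T, q k * (1 - q k) ≤ e / 4) :
    (volume.real (lowerBox z) - ((m : ℝ) ^ d)⁻¹ * ∑ k, q k) ^ 2
        + (((m : ℝ) ^ d)⁻¹) ^ 2 * ∑ k, q k * (1 - q k)
      ≤ (((m : ℝ) ^ d)⁻¹) ^ 2 * ((d : ℝ) * (m : ℝ) ^ (d - 1) / 4 + 9 / 2 * e) := by
  classical
  have hm' : (0 : ℝ) < m := by exact_mod_cast hm
  set g : (Fin d → Fin m) → ℝ :=
    fun k => (ProbabilityTheory.cond volume (gridCell m k)).real (lowerBox z) with hg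
  have hT' : (T.card : ℝ) ≤ 2 := by exact_mod_cast hT
  have hlam : volume.real (lowerBox z) = ((m : ℝ) ^ d)⁻¹ * ∑ k, g k := by
    simp only [hg, cond_gridCell_real]
    rw [← Finset.mul_sum, sum_volume_gridCell_inter_lowerBox hm hz, inv_mul_cancel_left₀]
    positivity
  have hdiff : |∑ k, (g k - q k)| ≤ 2 * e := by
    rw [← Finset.sum_subset (Finset.subset_univ T) fun k _ hk => by rw [hq k hk, sub_self]]
    calc |∑ k ∈ T, (g k - q k)| ≤ ∑ k ∈ T, |g k - q k| := Finset.abs_sum_le_sum_abs _ _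
      _ ≤ T.card • e := Finset.sum_le_card_nsmul _ _ _ hbias
      _ ≤ 2 * e := by
        rw [nsmul_eq_mul]
        exact mul_le_mul_of_nonneg_right hT' he0
  have hdiff_sq : (∑ k, (g k - q k)) ^ 2 ≤ 4 * e := by
    have h := sq_le_sq' (neg_le_of_abs_le hdiff) (le_of_abs_le hdiff)
    nlinarith
  set E : Finset (Fin d → Fin m) :=
    Finset.univ.filter fun k => ∃ j, (k j : ℕ) = ⌊(m : ℝ) * z j⌋₊ with hE
  have hEcard : (E.card : ℝ) ≤ d * (m : ℝ) ^ (d - 1) := by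
    exact_mod_cast card_filter_exists_coord_eq_le (m := m) fun j => ⌊(m : ℝ) * z j⌋₊
  have hsum : ∑ k, q k * (1 - q k) ≤ (d : ℝ) * (m : ℝ) ^ (d - 1) / 4 + e / 2 := by
    have hterm (k : Fin d → Fin m) : q k * (1 - q k)
        ≤ (if k ∈ E then 1 / 4 else 0) + (if k ∈ T then e / 4 else 0) := by
      by_cases hkT : k ∈ T
      · have h := hvar k hkT
        split_ifs <;> linarith
      · by_cases hkE : k ∈ E
        · simpa [hkT, hkE] using mul_one_sub_le_quarter (q k)
        · have hk' : ¬ ∃ j, (k j : ℕ) = ⌊(m : ℝ) * z j⌋₊ := by simpa [hE] using hkE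
          rw [hq k hkT]
          rcases cond_gridCell_lowerBox_eq_zero_or_one hm hz hk' with h | h <;>
            simp [h, hkT, hkE]
    refine (Finset.sum_le_sum fun k _ => hterm k).trans ?_
    rw [Finset.sum_add_distrib, Finset.sum_ite_mem, Finset.sum_ite_mem, Finset.univ_inter,
      Finset.univ_inter, Finset.sum_const, Finset.sum_const, nsmul_eq_mul, nsmul_eq_mul]
    nlinarith
  rw [hlam, ← mul_sub, ← Finset.sum_sub_distrib, mul_pow, ← mul_add]
  refine mul_le_mul_of_nonneg_left ?_ (sq_nonneg _)
  linarith

theorem cond_real_lowerBox_eq_zero {d : ℕ} {s : Set (Fin d → ℝ)} {z : Fin d → ℝ} {j : Fin d}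
    {t : ℝ} (hs : ∀ x ∈ s, t ≤ x j) (hz : z j ≤ t) :
    (ProbabilityTheory.cond volume s).real (lowerBox z) = 0 := by
  have hempty : lowerBox z ∩ s = ∅ := by
    ext x
    simp only [Set.mem_inter_iff, Set.mem_empty_iff_false, iff_false, not_and]
    intro hx hxs
    have h1 := hs x hxs
    have h2 := (hx j).2
    linarith
  simp [measureReal_def, ProbabilityTheory.cond,
    Measure.restrict_apply (measurableSet_lowerBox z), hempty]

theorem isClosed_I2 : IsClosed I2 := isClosed_Icc.prod isClosed_Icc

theorem Omega1_subset_I2 (θ : ℝ) : Omega1 θ ⊆ I2 := by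
  unfold Omega1
  split_ifs
  · exact Set.prod_mono (Set.Icc_subset_Icc_right (by norm_num)) subset_rfl
  · exact fun p hp => hp.1
  · exact fun p hp => hp.1

theorem Omega2_subset_I2 (θ : ℝ) : Omega2 θ ⊆ I2 :=
  closure_minimal Set.sdiff_subset isClosed_I2

theorem le_coord_of_mem_cornerCell {m d : ℕ} {hd : 2 ≤ d} {θ : ℝ} {i : Fin 2} {x : Fin d → ℝ}
    (hx : x ∈ cornerCell m d hd θ i) : ((m : ℝ) - 1) / m ≤ x ⟨1, by omega⟩ := by
  obtain ⟨y, ⟨hy, -⟩, rfl⟩ := hx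
  have hI : (y ⟨0, by omega⟩, y ⟨1, by omega⟩) ∈ I2 := by
    split_ifs at hy
    · exact Omega1_subset_I2 θ hy
    · exact Omega2_subset_I2 θ hy
  have h0 : 0 ≤ y ⟨1, by omega⟩ := hI.2.1
  have : 0 ≤ y ⟨1, by omega⟩ / m := by positivity
  simpa [anchor] using this

open scoped Classical in
/-- The indices of the two strata of `OmegaStarSim` that are not grid cells. -/
def cornerIndices (m d : ℕ) : Finset (Fin d → Fin m) :=
  (Finset.univ.filter fun k => ∀ j : Fin d, (k j : ℕ) = if (j : ℕ) = 0 then m - 2 else m - 1)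
    ∪ Finset.univ.filter fun k => ∀ j : Fin d, (k j : ℕ) = m - 1

theorem card_cornerIndices_le (m d : ℕ) : (cornerIndices m d).card ≤ 2 := by
  classical
  have hone (c : Fin d → ℕ) :
      (Finset.univ.filter fun k : Fin d → Fin m => ∀ j, (k j : ℕ) = c j).card ≤ 1 := by
    refine Finset.card_le_one.2 fun k hk l hl => ?_
    simp only [Finset.mem_filter, Finset.mem_univ, true_and] at hk hl
    exact funext fun j => Fin.ext ((hk j).trans (hl j).symm)
  unfold cornerIndices
  exact (Finset.card_union_le _ _).trans (add_le_add (hone _) (hone _))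

theorem OmegaStarSim_of_notMem {m d : ℕ} {hd : 2 ≤ d} {θ : ℝ} {k : Fin d → Fin m}
    (hk : k ∉ cornerIndices m d) : OmegaStarSim m d hd θ k = gridCell m k := by
  classical
  simp only [cornerIndices, Finset.mem_union, Finset.mem_filter, Finset.mem_univ, true_and,
    not_or] at hk
  rw [OmegaStarSim, if_neg hk.1, if_neg hk.2]

theorem le_coord_of_mem_OmegaStarSim {m d : ℕ} {hd : 2 ≤ d} {θ : ℝ} {k : Fin d → Fin m}
    (hk : k ∈ cornerIndices m d) {x : Fin d → ℝ} (hx : x ∈ OmegaStarSim m d hd θ k) :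
    ((m : ℝ) - 1) / m ≤ x ⟨1, by omega⟩ := by
  classical
  simp only [cornerIndices, Finset.mem_union, Finset.mem_filter, Finset.mem_univ, true_and] at hk
  unfold OmegaStarSim at hx
  split_ifs at hx with h1 h2
  · exact le_coord_of_mem_cornerCell hx
  · exact le_coord_of_mem_cornerCell hx
  · exact absurd hk (not_or.2 ⟨h1, h2⟩)

theorem le_coord_of_mem_gridCell {m d : ℕ} (hd : 2 ≤ d) (hm : 0 < m) {k : Fin d → Fin m}
    (hk : k ∈ cornerIndices m d) {x : Fin d → ℝ} (hx : x ∈ gridCell m k) :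
    ((m : ℝ) - 1) / m ≤ x ⟨1, by omega⟩ := by
  classical
  simp only [cornerIndices, Finset.mem_union, Finset.mem_filter, Finset.mem_univ, true_and] at hk
  have hk1 : (k ⟨1, by omega⟩ : ℕ) = m - 1 := by
    rcases hk with h | h
    · simpa using h ⟨1, by omega⟩
    · exact h _
  have h := (hx ⟨1, by omega⟩ (Set.mem_univ _)).1
  rwa [hk1, Nat.cast_sub hm, Nat.cast_one] at h

theorem volume_real_unitCube_inter_lt {d : ℕ} (j : Fin d) {t : ℝ} (ht0 : 0 ≤ t) (ht1 : t ≤ 1) :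
    volume.real ({z : Fin d → ℝ | t < z j} ∩ unitCube d) = 1 - t := by
  have heq : {z : Fin d → ℝ | t < z j} ∩ unitCube d
      = Set.univ.pi (Function.update (fun _ => Set.Icc (0 : ℝ) 1) j (Set.Ioc t 1)) := by
    ext z
    simp only [unitCube, Set.mem_inter_iff, Set.mem_ofPred_eq, Set.mem_univ_pi]
    constructor
    · rintro ⟨h1, h2⟩ i
      rcases eq_or_ne i j with rfl | hij
      · simpa using ⟨h1, (h2 i).2⟩
      · simpa [hij] using h2 i
    · intro h
      have hj : t < z j ∧ z j ≤ 1 := by simpa using h j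
      refine ⟨hj.1, fun i => ?_⟩
      rcases eq_or_ne i j with rfl | hij
      · exact ⟨ht0.trans hj.1.le, hj.2⟩
      · simpa [hij] using h i
  have hvol (i : Fin d) : volume (Function.update (fun _ => Set.Icc (0 : ℝ) 1) j (Set.Ioc t 1) i)
      = if i = j then ENNReal.ofReal (1 - t) else 1 := by
    rcases eq_or_ne i j with rfl | hij
    · simp
    · simp [hij]
  rw [measureReal_def, heq, volume_pi_pi]
  simp only [hvol, Finset.prod_ite_eq', Finset.mem_univ, if_true]
  exact ENNReal.toReal_ofReal (by linarith)

theorem neg_le_Pfun {θ : ℝ} (hθ : θ ∈ Set.Icc 0 (π / 2)) : -(1 / 12) ≤ Pfun θ := by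
  have htan : 0 ≤ tan θ := tan_nonneg_of_nonneg_of_le_pi_div_two hθ.1 hθ.2
  unfold Pfun
  split_ifs with h1 h2
  · have hlt : tan θ < 1 / 2 := by
      rw [← tan_arctan (1 / 2)]
      exact tan_lt_tan_of_lt_of_lt_pi_div_two (by linarith [hθ.1, pi_pos])
        (arctan_lt_pi_div_two _) h1
    have h3 : 0 ≤ tan θ ^ 3 := by positivity
    nlinarith [sq_nonneg (tan θ)]
  · norm_num
  · have hgt : arctan (1 / 2) < θ := lt_of_le_of_ne (not_lt.1 h1) (Ne.symm h2)
    rw [← tan_inv_eq_cot]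
    have hcot0 : 0 ≤ (tan θ)⁻¹ := inv_nonneg.2 htan
    have hcot2 : (tan θ)⁻¹ ≤ 2 := by
      rcases hθ.2.eq_or_lt with h | h
      · rw [h, tan_pi_div_two]
        norm_num
      · have h3 : 1 / 2 < tan θ := by
          conv_lhs => rw [← tan_arctan (1 / 2)]
          exact tan_lt_tan_of_lt_of_lt_pi_div_two (neg_pi_div_two_lt_arctan _) h hgt
        exact inv_le_of_inv_le₀ (by norm_num) (by linarith)
    have h3 : 0 ≤ (tan θ)⁻¹ ^ 3 := by positivity
    nlinarith [sq_nonneg (tan θ)⁻¹]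

theorem expL2sq_OmegaStarSim_le {m d : ℕ} (hd : 2 ≤ d) (hm : 0 < m) (θ : ℝ) :
    expL2sq (OmegaStarSim m d hd θ)
      ≤ (((m : ℝ) ^ d)⁻¹) ^ 2 * ((d : ℝ) * (m : ℝ) ^ (d - 1) / 4 + 9 / 2 * (m : ℝ)⁻¹) := by
  have hm' : (1 : ℝ) ≤ m := by exact_mod_cast hm
  set ν : (Fin d → Fin m) → Measure (Fin d → ℝ) :=
    fun k => ProbabilityTheory.cond volume (OmegaStarSim m d hd θ k) with hν
  have hν' (k) : ν k = 0 ∨ IsProbabilityMeasure (ν k) := cond_eq_zero_or_isProbabilityMeasure _ _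
  rw [expL2sq, stratified]
  by_cases hall : ∀ k, IsProbabilityMeasure (ν k)
  swap
  · have hfin (k) : IsFiniteMeasure (ν k) := by
      rcases hν' k with h | h
      · rw [h]
        infer_instance
      · infer_instance
    push Not at hall
    obtain ⟨k, hk⟩ := hall
    have hk0 : ν k = 0 := (hν' k).resolve_right hk
    have hpi : Measure.pi ν = 0 := by
      rw [← Measure.measure_univ_eq_zero, Measure.pi_univ]
      exact Finset.prod_eq_zero (Finset.mem_univ k) (by simp [hk0])
    rw [hpi, integral_zero_measure]
    positivity
  set j : Fin d := ⟨1, by omega⟩ with hj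
  set t : ℝ := ((m : ℝ) - 1) / m with ht
  set C : Set (Fin d → ℝ) := {z | t < z j} with hC
  have hCm : MeasurableSet C := measurableSet_lt measurable_const (measurable_pi_apply j)
  have ht0 : 0 ≤ t := div_nonneg (by linarith) (by linarith)
  have ht1 : 1 - t = (m : ℝ)⁻¹ := by
    rw [ht]
    field_simp
    ring
  have hcard : (Fintype.card (Fin d → Fin m) : ℝ) = (m : ℝ) ^ d := by simp
  have hfin : IsFiniteMeasure (volume.restrict (unitCube d)) := ⟨by simp [volume_unitCube]⟩
  have huniv : (volume.restrict (unitCube d)).real Set.univ = 1 := by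
    simp [measureReal_def, volume_unitCube]
  have hCint : Integrable (C.indicator fun _ => (1 : ℝ)) (volume.restrict (unitCube d)) :=
    (integrable_const 1).indicator hCm
  have hintC : ∫ z in unitCube d, C.indicator (fun _ => (1 : ℝ)) z = (m : ℝ)⁻¹ := by
    rw [integral_indicator hCm, setIntegral_const, smul_eq_mul, mul_one,
      measureReal_restrict_apply hCm,
      volume_real_unitCube_inter_lt j ht0 (by linarith [inv_nonneg.2 (zero_le_one.trans hm')]),
      ht1]
  have hbound : ∀ z ∈ unitCube d, ∫ P, ((volume (lowerBox z)).toReal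
      - (Fintype.card (Fin d → Fin m) : ℝ)⁻¹ * (Nat.card {i // P i ∈ lowerBox z} : ℝ)) ^ 2
        ∂(Measure.pi ν) ≤ (((m : ℝ) ^ d)⁻¹) ^ 2 * ((d : ℝ) * (m : ℝ) ^ (d - 1) / 4
          + 9 / 2 * C.indicator (fun _ => (1 : ℝ)) z) := by
    intro z hz
    rw [integral_sq_sub_card_pi ν (measurableSet_lowerBox z), hcard]
    have hgp (k : Fin d → Fin m) :
        IsProbabilityMeasure (ProbabilityTheory.cond volume (gridCell m k)) :=
      ProbabilityTheory.cond_isProbabilityMeasure_of_finite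
        (by rw [volume_gridCell, Ne, ENNReal.ofReal_eq_zero, not_le]; positivity)
        (by rw [volume_gridCell]; exact ENNReal.ofReal_ne_top)
    refine mean_sq_error_le hm hz (fun k => (ν k).real (lowerBox z)) (cornerIndices m d)
      (card_cornerIndices_le m d) (Set.indicator_nonneg (fun _ _ => zero_le_one) z)
      (Set.indicator_le_self' (fun _ _ => zero_le_one) z) ?_ ?_ ?_
    · intro k hk
      simp only [hν, OmegaStarSim_of_notMem hk]
    · intro k hk
      by_cases hzC : z ∈ C
      · rw [Set.indicator_of_mem hzC, abs_le]
        constructor <;> linarith [measureReal_le_one (μ := ν k) (s := lowerBox z),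
          measureReal_nonneg (μ := ν k) (s := lowerBox z),
          measureReal_le_one (μ := ProbabilityTheory.cond volume (gridCell m k))
            (s := lowerBox z),
          measureReal_nonneg (μ := ProbabilityTheory.cond volume (gridCell m k))
            (s := lowerBox z)]
      · have hzt : z j ≤ t := not_lt.1 hzC
        rw [Set.indicator_of_notMem hzC,
          cond_real_lowerBox_eq_zero (fun x hx => le_coord_of_mem_gridCell hd hm hk hx) hzt,
          cond_real_lowerBox_eq_zero (fun x hx => le_coord_of_mem_OmegaStarSim hk hx) hzt]
        simp
    · intro k hk
      by_cases hzC : z ∈ C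
      · rw [Set.indicator_of_mem hzC]
        exact mul_one_sub_le_quarter _
      · have hzt : z j ≤ t := not_lt.1 hzC
        rw [Set.indicator_of_notMem hzC,
          cond_real_lowerBox_eq_zero (fun x hx => le_coord_of_mem_OmegaStarSim hk hx) hzt]
        simp
  rw [integral_L2sq_pi ν]
  calc _ ≤ ∫ z in unitCube d, (((m : ℝ) ^ d)⁻¹) ^ 2 * ((d : ℝ) * (m : ℝ) ^ (d - 1) / 4
          + 9 / 2 * C.indicator (fun _ => (1 : ℝ)) z) := by
        refine integral_mono_of_nonneg
          (Filter.Eventually.of_forall fun z => integral_nonneg fun P => sq_nonneg _)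
          (((integrable_const _).add (hCint.const_mul _)).const_mul _) ?_
        filter_upwards [ae_restrict_mem (measurableSet_unitCube d)] with z hz
        exact hbound z hz
    _ = _ := by
        rw [integral_const_mul, integral_add (integrable_const _) (hCint.const_mul _),
          integral_const, integral_const_mul, hintC, huniv, one_smul]

/-- For integers `m ≥ d ≥ 2`, `N = m^d`, and `θ ∈ [0, π/2]`, the expected
squared `L₂`-discrepancy of the stratified sample from `Ω*∼(θ)` is at most
`d / N^(1 + 1/d) + (1/N³)·(1/3^(d-2))·P(θ)`. -/
theorem expL2sq_OmegaStarSim_le_bound (m d : ℕ) (hd : 2 ≤ d) (hm : d ≤ m)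
    (θ : ℝ) (hθ : θ ∈ Set.Icc 0 (π / 2)) :
    expL2sq (OmegaStarSim m d hd θ)
      ≤ (d : ℝ) / ((m : ℝ) ^ d) ^ ((1 : ℝ) + 1 / d)
        + 1 / ((m : ℝ) ^ d) ^ 3 * (1 / (3 : ℝ) ^ (d - 2)) * Pfun θ := by
  have hm2 : 2 ≤ m := hd.trans hm
  have hm0 : (0 : ℝ) < m := by exact_mod_cast (by omega : 0 < m)
  have hm2' : (2 : ℝ) ≤ m := by exact_mod_cast hm2
  have hd2 : (2 : ℝ) ≤ d := by exact_mod_cast hd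
  refine (expL2sq_OmegaStarSim_le hd (by omega) θ).trans ?_
  have hrpow : ((m : ℝ) ^ d) ^ ((1 : ℝ) + 1 / d) = (m : ℝ) ^ d * m := by
    rw [rpow_add (by positivity), rpow_one, one_div, pow_rpow_inv_natCast hm0.le (by omega)]
  rw [hrpow]
  obtain ⟨n, rfl⟩ : ∃ n, d = n + 1 := ⟨d - 1, by omega⟩
  have hn : (m : ℝ) ≤ (m : ℝ) ^ n := le_self_pow₀ (by linarith) (by omega)
  set N : ℝ := (m : ℝ) ^ (n + 1) with hN
  have hN0 : 0 < N := by positivity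
  have hN1 : 1 ≤ N := one_le_pow₀ (by linarith)
  set D : ℝ := ((n + 1 : ℕ) : ℝ) with hD
  have hmain : D / (N * m) = N⁻¹ ^ 2 * (D * (m : ℝ) ^ n) := by
    rw [hN]
    field_simp
    ring
  have hthree : 1 / (3 : ℝ) ^ (n + 1 - 2) ≤ 1 := by
    rw [div_le_one (by positivity)]
    exact one_le_pow₀ (by norm_num)
  have hcoef : 1 / N ^ 3 * (1 / (3 : ℝ) ^ (n + 1 - 2)) ≤ N⁻¹ ^ 2 := by
    have h1 : 1 / N ^ 3 ≤ N⁻¹ ^ 2 := by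
      rw [inv_pow, one_div]
      exact inv_anti₀ (by positivity) (pow_le_pow_right₀ hN1 (by norm_num))
    exact (mul_le_of_le_one_right (by positivity) hthree).trans h1
  have hP : -(N⁻¹ ^ 2 * (1 / 12))
      ≤ 1 / N ^ 3 * (1 / (3 : ℝ) ^ (n + 1 - 2)) * Pfun θ := by
    have h0 : 0 ≤ 1 / N ^ 3 * (1 / (3 : ℝ) ^ (n + 1 - 2)) := by positivity
    nlinarith [mul_le_mul_of_nonneg_left (neg_le_Pfun hθ) h0]
  have hinv : (m : ℝ)⁻¹ ≤ 1 / 2 := by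
    rw [one_div]
    exact inv_anti₀ (by norm_num) hm2'
  have hDm : 4 ≤ D * (m : ℝ) ^ n := by nlinarith
  have hkey : N⁻¹ ^ 2 * (D * (m : ℝ) ^ n / 4 + 9 / 2 * (m : ℝ)⁻¹)
      ≤ N⁻¹ ^ 2 * (D * (m : ℝ) ^ n - 1 / 12) :=
    mul_le_mul_of_nonneg_left (by linarith) (by positivity)
  rw [hmain, Nat.add_sub_cancel]
  linarith
end

section
/- Let θ satisfy arctan(1/2) ≤ θ < π/2 and let Ω₁(θ) = {(x₁,x₂) ∈ [0,2]×[0,1] : (x₁−1)·tan θ + x₂ ≤ 1/2}. Then ∫_{Ω₁(θ)} x₁²x₂² d(x₁,x₂) = 1/9 − 1/(12·tanθ) + 1/(30·tan²θ) − 1/(240·tan³θ). -/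
open MeasureTheory Real Set

noncomputable section

/-- The squared `L₂`-discrepancy over a set `K ⊆ ℝ²` of a point configuration `P`:
`∫_K (λ((-∞,x] ∩ K)/λ(K) - (1/N) #{i : P i ∈ (-∞,x]})² dx`. -/
def L2sqOn (K : Set (ℝ × ℝ)) {ι : Type} [Fintype ι] (P : ι → ℝ × ℝ) : ℝ :=
  ∫ x in K,
    ((volume (Set.Iic x ∩ K)).toReal / (volume K).toReal
      - (Fintype.card ι : ℝ)⁻¹ * (Nat.card {i // P i ∈ Set.Iic x} : ℝ)) ^ 2

/-- Expected squared `L₂`-discrepancy over `K ⊆ ℝ²` of the stratified sample from the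
partition `Ω` of `K`: the points are independent, the `i`-th uniformly distributed on `Ω i`. -/
def expL2sqOn (K : Set (ℝ × ℝ)) {ι : Type} [Fintype ι] (Ω : ι → Set (ℝ × ℝ)) : ℝ :=
  ∫ P, L2sqOn K P ∂(Measure.pi fun i => ProbabilityTheory.cond volume (Ω i))

end

/-- Fubini over a region lying between the graphs of `l` and `u` over the second coordinate. -/
theorem setIntegral_eq_intervalIntegral_of_graphs {f : ℝ × ℝ → ℝ} {l u : ℝ → ℝ} {a b : ℝ}
    (hab : a ≤ b) (hlu : ∀ y ∈ Icc a b, l y ≤ u y)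
    (hS : MeasurableSet {p : ℝ × ℝ | p.2 ∈ Icc a b ∧ p.1 ∈ Icc (l p.2) (u p.2)})
    (hf : IntegrableOn f {p : ℝ × ℝ | p.2 ∈ Icc a b ∧ p.1 ∈ Icc (l p.2) (u p.2)}) :
    ∫ p in {p : ℝ × ℝ | p.2 ∈ Icc a b ∧ p.1 ∈ Icc (l p.2) (u p.2)}, f p
      = ∫ y in a..b, ∫ x in l y..u y, f (x, y) := by
  rw [← integral_indicator hS, Measure.volume_eq_prod, integral_prod_symm _
    (by rw [← Measure.volume_eq_prod]; exact hf.integrable_indicator hS),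
    intervalIntegral.integral_of_le hab, ← integral_Icc_eq_integral_Ioc,
    ← integral_indicator measurableSet_Icc]
  congr 1 with y
  by_cases hy : y ∈ Icc a b
  · rw [indicator_of_mem hy, intervalIntegral.integral_of_le (hlu y hy),
      ← integral_Icc_eq_integral_Ioc, ← integral_indicator measurableSet_Icc]
    congr 1 with x
    simp only [indicator, mem_ofPred_eq, hy, true_and]
  · simp only [indicator, mem_ofPred_eq, hy, false_and, if_false, integral_zero]

/-- The second moment integral over the part of the unit-height strip between the vertical axis
and the line through `(1, 1/2)` of inverse slope `-c`. -/
theorem intervalIntegral_sq_mul_sq_of_line (c : ℝ) :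
    ∫ y in (0 : ℝ)..1, ∫ x in (0 : ℝ)..(1 + (1 / 2 - y) * c), x ^ 2 * y ^ 2
      = 1 / 9 - c / 12 + c ^ 2 / 30 - c ^ 3 / 240 := by
  have hderiv : ∀ y ∈ uIcc (0 : ℝ) 1, HasDerivAt
      (fun y : ℝ => ((1 + c / 2) ^ 3 * y ^ 3 / 3 - 3 * (1 + c / 2) ^ 2 * c * y ^ 4 / 4
        + 3 * (1 + c / 2) * c ^ 2 * y ^ 5 / 5 - c ^ 3 * y ^ 6 / 6) / 3)
      (∫ x in (0 : ℝ)..(1 + (1 / 2 - y) * c), x ^ 2 * y ^ 2) y := by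
    intro y _
    rw [intervalIntegral.integral_mul_const, integral_pow]
    have h := fun n : ℕ => hasDerivAt_pow n y
    refine HasDerivAt.congr_deriv (((((((h 3).const_mul ((1 + c / 2) ^ 3)).div_const 3).sub
      (((h 4).const_mul (3 * (1 + c / 2) ^ 2 * c)).div_const 4)).add
      (((h 5).const_mul (3 * (1 + c / 2) * c ^ 2)).div_const 5)).sub
      (((h 6).const_mul (c ^ 3)).div_const 6)).div_const 3) ?_
    norm_num
    ring
  rw [intervalIntegral.integral_eq_sub_of_hasDerivAt hderiv]
  · ring
  · simp only [intervalIntegral.integral_mul_const, integral_pow]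
    exact Continuous.intervalIntegrable (by fun_prop) _ _

/-- For `arctan (1/2) ≤ θ < π/2` and the trapezoid
`Ω₁(θ) = {(x₁,x₂) ∈ [0,2] × [0,1] : (x₁-1)·tan θ + x₂ ≤ 1/2}`:
`∫_{Ω₁(θ)} x₁² x₂² dx = 1/9 - 1/(12 tan θ) + 1/(30 tan² θ) - 1/(240 tan³ θ)`. -/
theorem integral_sq_over_trapezoid (θ : ℝ) (h1 : arctan (1 / 2) ≤ θ) (h2 : θ < π / 2) :
    ∫ x in {p ∈ I2 | (p.1 - 1) * tan θ + p.2 ≤ 1 / 2}, x.1 ^ 2 * x.2 ^ 2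
      = 1 / 9 - 1 / (12 * tan θ) + 1 / (30 * tan θ ^ 2) - 1 / (240 * tan θ ^ 3) := by
  have ht : 1 / 2 ≤ tan θ := by
    rw [← tan_arctan (1 / 2)]
    exact strictMonoOn_tan.monotoneOn (arctan_mem_Ioo _)
      ⟨(neg_pi_div_two_lt_arctan _).trans_le h1, h2⟩ h1
  generalize tan θ = t at ht ⊢
  have ht0 : 0 < t := by linarith
  have hc2 : t⁻¹ ≤ 2 := by
    rw [inv_le_comm₀ ht0 two_pos]
    linarith
  have hc0 : 0 < t⁻¹ := inv_pos.mpr ht0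
  have hline : ∀ x y : ℝ, (x - 1) * t + y ≤ 1 / 2 ↔ x ≤ 1 + (1 / 2 - y) * t⁻¹ := by
    intro x y
    rw [← sub_le_iff_le_add', ← div_eq_mul_inv, le_div_iff₀ ht0, le_sub_iff_add_le]
  have hset : {p ∈ I2 | (p.1 - 1) * t + p.2 ≤ 1 / 2} =
      {p : ℝ × ℝ | p.2 ∈ Icc (0 : ℝ) 1 ∧ p.1 ∈ Icc (0 : ℝ) (1 + (1 / 2 - p.2) * t⁻¹)} := by
    ext ⟨x, y⟩
    simp only [I2, mem_ofPred_eq, mem_prod, mem_Icc, hline]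
    constructor
    · rintro ⟨⟨⟨hx, -⟩, hy⟩, h⟩
      exact ⟨hy, hx, h⟩
    · rintro ⟨hy, hx, h⟩
      exact ⟨⟨⟨hx, by nlinarith⟩, hy⟩, h⟩
  have hmeas : MeasurableSet {p ∈ I2 | (p.1 - 1) * t + p.2 ≤ 1 / 2} :=
    (measurableSet_Icc.prod measurableSet_Icc).inter
      (measurableSet_le (f := fun p : ℝ × ℝ => (p.1 - 1) * t + p.2) (g := fun _ => 1 / 2)
        (by fun_prop) (by fun_prop))
  have hint : IntegrableOn (fun p : ℝ × ℝ => p.1 ^ 2 * p.2 ^ 2)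
      {p ∈ I2 | (p.1 - 1) * t + p.2 ≤ 1 / 2} :=
    (ContinuousOn.integrableOn_compact (isCompact_Icc.prod isCompact_Icc)
      (by fun_prop)).mono_set (fun _ hp => hp.1)
  rw [hset] at hmeas hint ⊢
  rw [setIntegral_eq_intervalIntegral_of_graphs (l := fun _ => 0)
    (u := fun y => 1 + (1 / 2 - y) * t⁻¹) zero_le_one
    (fun y hy => by nlinarith [hy.1, hy.2]) hmeas hint, intervalIntegral_sq_mul_sq_of_line]
  field_simp
end

section
/- Let θ satisfy arctan(1/2) ≤ θ < π/2. With I = [0,2]×[0,1] and Ω₁(θ) = {(x₁,x₂) ∈ I : (x₁−1)·tan θ + x₂ ≤ 1/2}, one has ∫_I λ(Ω₁(θ) ∩ [0,x])² dx = 4/9 + 1/(12·tanθ) − 1/(60·tan²θ) − 1/(720·tan³θ). -/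
open MeasureTheory Real Set

/-- The square of the positive part is differentiable, with derivative twice the positive part. -/
lemma hasDerivAt_max_zero_sq (u : ℝ) :
    HasDerivAt (fun v : ℝ => (max v 0) ^ 2) (2 * max u 0) u := by
  rcases lt_trichotomy u 0 with hu | rfl | hu
  · rw [max_eq_right hu.le, mul_zero]
    refine (hasDerivAt_const u (0 : ℝ)).congr_of_eventuallyEq ?_
    filter_upwards [Iio_mem_nhds hu] with v hv
    simp [max_eq_right (le_of_lt (mem_Iio.mp hv))]
  · rw [max_self, mul_zero, hasDerivAt_iff_isLittleO_nhds_zero]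
    have hO : (fun h : ℝ => (max h 0) ^ 2) =O[nhds 0] fun h : ℝ => h ^ 2 := by
      refine Asymptotics.isBigO_of_le _ fun h => ?_
      rw [norm_pow, norm_pow, Real.norm_eq_abs, Real.norm_eq_abs]
      refine pow_le_pow_left₀ (abs_nonneg _) ?_ 2
      rw [abs_of_nonneg (le_max_right h 0)]
      exact max_le (le_abs_self h) (abs_nonneg h)
    simpa using hO.trans_isLittleO (Asymptotics.isLittleO_pow_id one_lt_two)
  · rw [max_eq_left hu.le]
    refine (by simpa using hasDerivAt_pow 2 u : HasDerivAt (fun v : ℝ => v ^ 2) (2 * u) u)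
      |>.congr_of_eventuallyEq ?_
    filter_upwards [Ioi_mem_nhds hu] with v hv
    simp [max_eq_left (le_of_lt (mem_Ioi.mp hv))]

/-- Integral of the minimum of a constant and a decreasing affine function. -/
lemma integral_min_sub_mul {c : ℝ} (hc : 0 < c) (b x y : ℝ) :
    ∫ s in (0 : ℝ)..y, min x (b - c * s)
      = x * y - ((max (x - (b - c * y)) 0) ^ 2 - (max (x - b) 0) ^ 2) / (2 * c) := by
  have hderiv : ∀ s ∈ uIcc 0 y, HasDerivAt
      (fun s => x * s - (max (x - (b - c * s)) 0) ^ 2 / (2 * c)) (min x (b - c * s)) s := by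
    intro s _
    have haff : HasDerivAt (fun s : ℝ => x - (b - c * s)) c s := by
      simpa using (((hasDerivAt_id s).const_mul c).const_sub b).const_sub x
    have hsq := ((hasDerivAt_max_zero_sq (x - (b - c * s))).comp s haff).div_const (2 * c)
    refine (((hasDerivAt_id s).const_mul x).sub hsq).congr_deriv ?_
    rcases le_total x (b - c * s) with h | h
    · rw [min_eq_left h, max_eq_right (by linarith)]; simp
    · rw [min_eq_right h, max_eq_left (by linarith)]; field_simp; ring
  rw [intervalIntegral.integral_eq_sub_of_hasDerivAt hderiv
    (Continuous.intervalIntegrable (by fun_prop) _ _)]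
  simp only [mul_zero, sub_zero]
  ring

/-- The area of the part of the region `{p | 0 ≤ p.1 ≤ b - c * p.2}` in the box `[0,x] × [0,y]`. -/
lemma volume_inter_box_toReal {c b x y : ℝ} (hc : 0 < c) (hx : 0 ≤ x) (hy : 0 ≤ y)
    (hb : c * y ≤ b) :
    (volume {p : ℝ × ℝ | p.2 ∈ Icc 0 y ∧ p.1 ∈ Icc 0 (min x (b - c * p.2))}).toReal
      = x * y - ((max (x - (b - c * y)) 0) ^ 2 - (max (x - b) 0) ^ 2) / (2 * c) := by
  have hmeas : MeasurableSet
      {p : ℝ × ℝ | p.2 ∈ Icc 0 y ∧ p.1 ∈ Icc 0 (min x (b - c * p.2))} := by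
    simp only [mem_Icc]
    measurability
  have hslice : ∀ s : ℝ, volume ((fun r : ℝ => (r, s)) ⁻¹'
      {p : ℝ × ℝ | p.2 ∈ Icc 0 y ∧ p.1 ∈ Icc 0 (min x (b - c * p.2))})
      = (Icc 0 y).indicator (fun s => ENNReal.ofReal (min x (b - c * s))) s := by
    intro s
    by_cases hs : s ∈ Icc 0 y
    · rw [indicator_of_mem hs]
      have : (fun r : ℝ => (r, s)) ⁻¹'
          {p : ℝ × ℝ | p.2 ∈ Icc 0 y ∧ p.1 ∈ Icc 0 (min x (b - c * p.2))}
          = Icc 0 (min x (b - c * s)) := by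
        ext r
        simp only [mem_preimage, mem_ofPred_eq, hs, true_and]
      rw [this, Real.volume_Icc, sub_zero]
    · rw [indicator_of_notMem hs]
      have : (fun r : ℝ => (r, s)) ⁻¹'
          {p : ℝ × ℝ | p.2 ∈ Icc 0 y ∧ p.1 ∈ Icc 0 (min x (b - c * p.2))} = ∅ := by
        ext r
        simp only [mem_preimage, mem_ofPred_eq, hs, false_and, mem_empty_iff_false]
      rw [this, measure_empty]
  rw [Measure.volume_eq_prod, Measure.prod_apply_symm hmeas]
  simp_rw [hslice]
  rw [lintegral_indicator measurableSet_Icc, ← integral_eq_lintegral_of_nonneg_ae,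
    integral_Icc_eq_integral_Ioc, ← intervalIntegral.integral_of_le hy, integral_min_sub_mul hc]
  · filter_upwards [ae_restrict_mem measurableSet_Icc] with s hs
    have : c * s ≤ c * y := mul_le_mul_of_nonneg_left hs.2 hc.le
    exact le_min hx (sub_nonneg.mpr (this.trans hb))
  · exact (by fun_prop : Continuous fun s => min x (b - c * s)).aestronglyMeasurable

/-- The integral in the first variable of the squared area function of `volume_inter_box_toReal`. -/
lemma integral_sq_area {c b d y : ℝ} (hc : 0 < c) (hy : 0 ≤ y) (hb : c * y ≤ b) (hd : b ≤ d) :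
    ∫ x in (0 : ℝ)..d,
        (x * y - ((max (x - (b - c * y)) 0) ^ 2 - (max (x - b) 0) ^ 2) / (2 * c)) ^ 2
      = y ^ 2 * b ^ 3 / 3 - b * c ^ 2 * y ^ 4 / 3 + 2 * c ^ 3 * y ^ 5 / 15
        + (d - b) * (b * y - c * y ^ 2 / 2) ^ 2 := by
  set F : ℝ → ℝ := fun x =>
    (x * y - ((max (x - (b - c * y)) 0) ^ 2 - (max (x - b) 0) ^ 2) / (2 * c)) ^ 2 with hF
  have hcy : 0 ≤ c * y := mul_nonneg hc.le hy
  have hint : ∀ p q : ℝ, IntervalIntegrable F volume p q := fun p q =>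
    Continuous.intervalIntegrable (by fun_prop) _ _
  have hleft : ∫ x in (0 : ℝ)..(b - c * y), F x = y ^ 2 * (b - c * y) ^ 3 / 3 := by
    have : ∫ x in (0 : ℝ)..(b - c * y), F x = ∫ x in (0 : ℝ)..(b - c * y), x ^ 2 * y ^ 2 := by
      refine intervalIntegral.integral_congr fun x hx => ?_
      rw [uIcc_of_le (by linarith)] at hx
      simp only [hF]
      rw [max_eq_right (by linarith [hx.2]), max_eq_right (by linarith [hx.2])]
      ring
    rw [this, intervalIntegral.integral_mul_const, integral_pow]
    norm_num
    ring
  have hmid : ∫ x in (b - c * y)..b, F x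
      = y ^ 2 * (b ^ 3 - (b - c * y) ^ 3) / 3 - (b - c * y) * c ^ 2 * y ^ 4 / 3
        - c ^ 3 * y ^ 5 / 5 := by
    have hderiv : ∀ x ∈ uIcc (b - c * y) b, HasDerivAt (fun x : ℝ => y ^ 2 * x ^ 3 / 3
        - y / c * ((x - (b - c * y)) ^ 4 / 4 + (b - c * y) * (x - (b - c * y)) ^ 3 / 3)
        + (x - (b - c * y)) ^ 5 / (20 * c ^ 2)) (F x) x := by
      intro x hx
      rw [uIcc_of_le (by linarith)] at hx
      have hs := (hasDerivAt_id x).sub_const (b - c * y)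
      refine ((((hasDerivAt_pow 3 x).const_mul (y ^ 2)).div_const 3).sub
        ((((hs.pow 4).div_const 4).add
          (((hs.pow 3).const_mul (b - c * y)).div_const 3)).const_mul (y / c))).add
        ((hs.pow 5).div_const (20 * c ^ 2)) |>.congr_deriv ?_
      simp only [hF]
      rw [max_eq_left (by linarith [hx.1]), max_eq_right (by linarith [hx.2])]
      simp only [id]
      push_cast
      field_simp
      ring
    rw [intervalIntegral.integral_eq_sub_of_hasDerivAt hderiv (hint _ _)]
    field_simp
    ring
  have hright : ∫ x in b..d, F x = (d - b) * (b * y - c * y ^ 2 / 2) ^ 2 := by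
    have : ∫ x in b..d, F x = ∫ x in b..d, (b * y - c * y ^ 2 / 2) ^ 2 := by
      refine intervalIntegral.integral_congr fun x hx => ?_
      rw [uIcc_of_le hd] at hx
      simp only [hF]
      rw [max_eq_left (by linarith [hx.1]), max_eq_left (by linarith [hx.1])]
      congr 1
      field_simp
      ring
    rw [this, intervalIntegral.integral_const, smul_eq_mul]
  rw [← intervalIntegral.integral_add_adjacent_intervals (hint 0 (b - c * y)) (hint _ d),
    ← intervalIntegral.integral_add_adjacent_intervals (hint (b - c * y) b) (hint _ d),
    hleft, hmid, hright]
  ring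

/-- For `arctan (1/2) ≤ θ < π/2` and the trapezoid
`Ω₁(θ) = {(x₁,x₂) ∈ I : (x₁-1)·tan θ + x₂ ≤ 1/2}` of `I = [0,2] × [0,1]`:
`∫_I λ(Ω₁(θ) ∩ [0,x])² dx = 4/9 + 1/(12 tan θ) - 1/(60 tan² θ) - 1/(720 tan³ θ)`. -/
theorem integral_measure_trapezoid_inter_box_sq (θ : ℝ)
    (h1 : arctan (1 / 2) ≤ θ) (h2 : θ < π / 2) :
    ∫ x in I2, ((volume ({p ∈ I2 | (p.1 - 1) * tan θ + p.2 ≤ 1 / 2} ∩ Set.Icc 0 x)).toReal) ^ 2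
      = 4 / 9 + 1 / (12 * tan θ) - 1 / (60 * tan θ ^ 2) - 1 / (720 * tan θ ^ 3) := by
  have ht : 1 / 2 ≤ tan θ := by
    have hθ : -(π / 2) < θ := (neg_pi_div_two_lt_arctan _).trans_le h1
    rw [← arctan_tan hθ h2] at h1
    exact arctan_strictMono.le_iff_le.mp h1
  obtain ⟨c, hc⟩ : ∃ c, c = (tan θ)⁻¹ := ⟨_, rfl⟩
  have ht0 : 0 < tan θ := by linarith
  have hc0 : 0 < c := hc ▸ inv_pos.mpr ht0
  have hct : c * tan θ = 1 := by rw [hc, inv_mul_cancel₀ ht0.ne']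
  have hc2 : c ≤ 2 := by nlinarith
  have hside : ∀ r s : ℝ, (r - 1) * tan θ + s ≤ 1 / 2 ↔ r ≤ 1 + c / 2 - c * s := by
    intro r s
    rw [← mul_le_mul_iff_right₀ hc0]
    have : c * ((r - 1) * tan θ + s) = (r - 1) + c * s := by linear_combination (r - 1) * hct
    rw [this]
    constructor <;> intro h <;> linarith
  set f : ℝ × ℝ → ℝ := fun z => (z.1 * z.2 - ((max (z.1 - (1 + c / 2 - c * z.2)) 0) ^ 2
    - (max (z.1 - (1 + c / 2)) 0) ^ 2) / (2 * c)) ^ 2 with hf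
  have hfc : Continuous f := by fun_prop
  have harea : EqOn (fun x => ((volume ({p ∈ I2 | (p.1 - 1) * tan θ + p.2 ≤ 1 / 2}
      ∩ Set.Icc 0 x)).toReal) ^ 2) f I2 := by
    rintro ⟨x, y⟩ ⟨hx, hy⟩
    simp only [mem_Icc] at hx hy
    have hset : {p ∈ I2 | (p.1 - 1) * tan θ + p.2 ≤ 1 / 2} ∩ Set.Icc 0 (x, y)
        = {p : ℝ × ℝ | p.2 ∈ Icc 0 y ∧ p.1 ∈ Icc 0 (min x (1 + c / 2 - c * p.2))} := by
      ext ⟨r, s⟩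
      simp only [I2, mem_inter_iff, mem_ofPred_eq, mem_prod, mem_Icc, hside, le_min_iff,
        Prod.le_def, Prod.fst_zero, Prod.snd_zero]
      constructor
      · rintro ⟨⟨⟨⟨_, _⟩, _, _⟩, h⟩, ⟨h3, h4⟩, h5, h6⟩
        exact ⟨⟨h4, h6⟩, h3, h5, h⟩
      · rintro ⟨⟨h4, h6⟩, h3, h5, h⟩
        exact ⟨⟨⟨⟨h3, h5.trans hx.2⟩, h4, h6.trans hy.2⟩, h⟩, ⟨h3, h4⟩, h5, h6⟩
    simp only [hset, hf]
    rw [volume_inter_box_toReal hc0 hx.1 hy.1 (by nlinarith)]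
  have hI : MeasurableSet I2 := measurableSet_Icc.prod measurableSet_Icc
  rw [setIntegral_congr_fun hI harea, I2, Measure.volume_eq_prod, ← setIntegral_prod_swap,
    setIntegral_prod]
  swap
  · exact (hfc.comp continuous_swap).continuousOn.integrableOn_compact
      (isCompact_Icc.prod isCompact_Icc)
  have hinner : ∀ y ∈ Icc (0 : ℝ) 1, ∫ x in Icc (0 : ℝ) 2, f (Prod.swap (y, x))
      = ((1 + c / 2) ^ 3 / 3 + (1 - c / 2) * (1 + c / 2) ^ 2) * y ^ 2
        + (-((1 - c / 2) * (1 + c / 2) * c)) * y ^ 3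
        + (-((1 + c / 2) * c ^ 2 / 3) + (1 - c / 2) * c ^ 2 / 4) * y ^ 4
        + 2 * c ^ 3 / 15 * y ^ 5 := by
    intro y hy
    rw [integral_Icc_eq_integral_Ioc, ← intervalIntegral.integral_of_le zero_le_two]
    simp only [hf, Prod.swap_prod_mk]
    rw [integral_sq_area hc0 hy.1 (by nlinarith [hy.2]) (by linarith)]
    ring
  rw [setIntegral_congr_fun measurableSet_Icc hinner, integral_Icc_eq_integral_Ioc,
    ← intervalIntegral.integral_of_le zero_le_one,
    intervalIntegral.integral_add, intervalIntegral.integral_add, intervalIntegral.integral_add]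
  · simp only [intervalIntegral.integral_const_mul, integral_pow]
    have ht' : tan θ = c⁻¹ := by rw [hc, inv_inv]
    rw [ht']
    field_simp
    ring
  all_goals exact Continuous.intervalIntegrable (by fun_prop) _ _
end
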